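/- Let k ≥ 1, m,n ∈ ℕ, and let y, w, τ be elements of the A(S^7_q)-bimodule M = A(S^7_q) ⊗_B A(S^7_q) satisfying the four relations (i) q^{m+n} z_2 y + q^{m+n+1} w z_1 = τ z_2, (ii) z_3 y − q^{−k} w z_4 = τ z_3, (iii) q^{m+n} z_1* y − q^{m+n} w z_2* = τ z_1*, (iv) z_4* y + q^{1−k} w z_3* = τ z_4*. Then: τ (1 − q^2 R) = z_4* y z_4 + q^2 z_3 y z_3*; τ R = q^{m+n}(z_2 y z_2* + z_1* y z_1); τ a_{−(k+m+n)} = q^{−1} z_4* y z_1 − q^{−k} z_2 y z_3*; τ b_{−(k+m+n)} = q z_3 y z_1 + q^{−k−1} z_2 y z_4; τ (a_{k+m+n})* = q^{m+n−1} z_1* y z_4 − q^{k+m+n} z_3 y z_2*; and τ (b_{k+m+n})* = q^{m+n+1} z_1* y z_3* + q^{k+m+n−1} z_4* y z_2*. -/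

import Mathlib

open scoped TensorProduct

noncomputable section

namespace QIB

/-- Generators of `A(U_q(4))`: the matrix entries `t i j` and the extra generator `D_q⁻¹`. -/
abbrev genU : Type := (Fin 4 × Fin 4) ⊕ Unit

abbrev FU : Type := FreeAlgebra ℂ genU

def T (i j : Fin 4) : FU := FreeAlgebra.ι ℂ (Sum.inl (i, j))

def Dinv0 : FU := FreeAlgebra.ι ℂ (Sum.inr ())

/-- The length (number of inversions) of a permutation of `Fin 4`. -/
def plen (σ : Equiv.Perm (Fin 4)) : ℕ :=
  ((Finset.univ : Finset (Fin 4 × Fin 4)).filter fun p => p.1 < p.2 ∧ σ p.2 < σ p.1).card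

/-- The quantum determinant, as an element of the free algebra. -/
def Dq0 (q : ℝ) : FU :=
  ∑ σ : Equiv.Perm (Fin 4),
    ((-(q : ℂ)) ^ plen σ) • (T (σ 0) 0 * T (σ 1) 1 * T (σ 2) 2 * T (σ 3) 3)

/-- The defining relations of `A(U_q(4))`. -/
inductive relU (q : ℝ) : FU → FU → Prop
  | col {i j k : Fin 4} : i < j → relU q (T i k * T j k) ((q : ℂ) • (T j k * T i k))
  | row {i j k : Fin 4} : i < j → relU q (T k i * T k j) ((q : ℂ) • (T k j * T k i))
  | comm {i j k l : Fin 4} : i < j → k < l → relU q (T i l * T j k) (T j k * T i l)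
  | qcom {i j k l : Fin 4} : i < j → k < l →
      relU q (T i k * T j l - T j l * T i k) (((q : ℂ) - (q : ℂ)⁻¹) • (T j k * T i l))
  | dr : relU q (Dq0 q * Dinv0) 1
  | dl : relU q (Dinv0 * Dq0 q) 1

variable (q : ℝ)

/-- The algebra `A(U_q(4))`. -/
abbrev AU : Type := RingQuot (relU q)

/-- The generators `t i j` of `A(U_q(4))` (indices are 0-based). -/
def tt (i j : Fin 4) : AU q := RingQuot.mkAlgHom ℂ (relU q) (T i j)

/-- The generator `D_q⁻¹`. -/
def dI : AU q := RingQuot.mkAlgHom ℂ (relU q) Dinv0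

/-- The quantum determinant `D_q` in `A(U_q(4))`. -/
def Dq : AU q := RingQuot.mkAlgHom ℂ (relU q) (Dq0 q)

/-- The spanning set `R` of relation elements (0-based indices). -/
def Rset : Set (AU q) :=
  {tt q 0 2, tt q 2 0, tt q 0 3, tt q 3 0, tt q 1 3, tt q 3 1, tt q 1 2, tt q 2 1,
   tt q 0 0 - tt q 3 3, tt q 0 1 + tt q 3 2, tt q 1 0 + tt q 2 3, tt q 1 1 - tt q 2 2,
   tt q 0 0 * tt q 1 1 - (q : ℂ) • (tt q 0 1 * tt q 1 0) - 1}

/-- The right ideal `ℛ = R · A(U_q(4))`, as a `ℂ`-submodule. -/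
def RIdeal : Submodule ℂ (AU q) :=
  Submodule.span ℂ {y | ∃ x ∈ Rset q, ∃ a : AU q, y = x * a}

/-- The coalgebra `C = A(U_q(4)) / ℛ`. -/
abbrev Cq : Type := AU q ⧸ RIdeal q

/-- The canonical projection `r : A(U_q(4)) → C`. -/
def rr : AU q →ₗ[ℂ] Cq q := (RIdeal q).mkQ

lemma RIdeal_mul_right {y : AU q} (hy : y ∈ RIdeal q) (c : AU q) : y * c ∈ RIdeal q := by
  induction hy using Submodule.span_induction with
  | mem x hx =>
      obtain ⟨x0, hx0, a, rfl⟩ := hx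
      exact Submodule.subset_span ⟨x0, hx0, a * c, by rw [mul_assoc]⟩
  | zero => simp
  | add u v _ _ hu hv => simpa [add_mul] using (RIdeal q).add_mem hu hv
  | smul a u _ hu => simpa [smul_mul_assoc] using (RIdeal q).smul_mem a hu

/-- Auxiliary map for the right `A(U_q(4))`-module structure of `C`:
right multiplication by `c` descends to the quotient. -/
def cactAux (c : AU q) : Cq q →ₗ[ℂ] Cq q :=
  Submodule.liftQ (RIdeal q) ((RIdeal q).mkQ ∘ₗ LinearMap.mulRight ℂ c)
    (by
      intro y hy
      simp only [LinearMap.mem_ker, LinearMap.comp_apply, LinearMap.mulRight_apply,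
        Submodule.mkQ_apply, Submodule.Quotient.mk_eq_zero]
      exact RIdeal_mul_right q hy c)

@[simp] lemma cactAux_mk (c a : AU q) :
    cactAux q c (Submodule.Quotient.mk a) = (Submodule.Quotient.mk (a * c) : Cq q) := by
  simp [cactAux]

/-- The right `A(U_q(4))`-module structure `r(t) · t' := r(t t')` of `C`,
as a bilinear map `A(U_q(4)) →ₗ C →ₗ C`, `(c, x) ↦ x · c`. -/
def cact : AU q →ₗ[ℂ] Cq q →ₗ[ℂ] Cq q where
  toFun c := cactAux q c
  map_add' c c' := by
    refine LinearMap.ext fun x => ?_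
    obtain ⟨a, rfl⟩ := Submodule.Quotient.mk_surjective _ x
    simp only [cactAux_mk, mul_add, Submodule.Quotient.mk_add, LinearMap.add_apply]
  map_smul' s c := by
    refine LinearMap.ext fun x => ?_
    obtain ⟨a, rfl⟩ := Submodule.Quotient.mk_surjective _ x
    simp only [cactAux_mk, mul_smul_comm, Submodule.Quotient.mk_smul, RingHom.id_apply, LinearMap.smul_apply]

@[simp] lemma cact_mk (c a : AU q) : cact q c (rr q a) = rr q (a * c) := by
  simp [cact, rr]

/-- θ(k) = 1 for k ≥ 0 and 0 for k < 0. -/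
def thetaZ (k : ℤ) : ℂ := if 0 ≤ k then 1 else 0

/-- The linear basis elements `r^{k,m,n}` of `C`, given as representatives in `A(U_q(4))`. -/
def bas (k : ℤ) (m n : ℕ) : AU q :=
  if 0 ≤ k then tt q 0 0 ^ k.toNat * tt q 0 1 ^ m * tt q 1 0 ^ n
  else tt q 0 1 ^ m * tt q 1 0 ^ n * tt q 1 1 ^ (-k).toNat

/-! ### The quantum seven-sphere -/

/-- Generators of `A(S⁷_q)`: `(i, false)` is `z_i`, `(i, true)` is `z_i^*`. -/
abbrev genS : Type := Fin 4 × Bool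

abbrev FS : Type := FreeAlgebra ℂ genS

def Z0 (i : Fin 4) : FS := FreeAlgebra.ι ℂ (i, false)

def Zs0 (i : Fin 4) : FS := FreeAlgebra.ι ℂ (i, true)

/-- The defining relations of the ∗-algebra `A(S⁷_q)` (including the ∗-conjugate of the
first family of relations, so that the relation set is closed under the involution). -/
inductive relS (q : ℝ) : FS → FS → Prop
  | zz {i j : Fin 4} : i < j → relS q (Z0 i * Z0 j) ((q : ℂ) • (Z0 j * Z0 i))
  | ss {i j : Fin 4} : i < j → relS q (Zs0 j * Zs0 i) ((q : ℂ) • (Zs0 i * Zs0 j))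
  | sz {i j : Fin 4} : i ≠ j → relS q (Zs0 j * Z0 i) ((q : ℂ) • (Z0 i * Zs0 j))
  | szz {k : Fin 4} : relS q (Zs0 k * Z0 k)
      (Z0 k * Zs0 k + (1 - (q : ℂ) ^ 2) •
        ∑ j ∈ Finset.univ.filter (· < k), Z0 j * Zs0 j)
  | sum1 : relS q (∑ k : Fin 4, Z0 k * Zs0 k) 1

/-- The algebra `P = A(S⁷_q)`. -/
abbrev PA : Type := RingQuot (relS q)

/-- The generators `z_i` of `A(S⁷_q)` (0-based index). -/
def z (i : Fin 4) : PA q := RingQuot.mkAlgHom ℂ (relS q) (Z0 i)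

/-- The generators `z_i^*` of `A(S⁷_q)` (0-based index). -/
def zs (i : Fin 4) : PA q := RingQuot.mkAlgHom ℂ (relS q) (Zs0 i)

/-- The element `R = z₁ z₁^* + z₂ z₂^*` of `A(S⁷_q)`. -/
def RRe [StarRing (PA q)] : PA q := z q 0 * star (z q 0) + z q 1 * star (z q 1)

/-- The element `a = z₁ z₄^* − z₂ z₃^*` of `A(S⁷_q)`. -/
def aa [StarRing (PA q)] : PA q := z q 0 * star (z q 3) - z q 1 * star (z q 2)

/-- The element `b = z₁ z₃ + q⁻¹ z₂ z₄` of `A(S⁷_q)`. -/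
def bb : PA q := z q 0 * z q 2 + (q : ℂ)⁻¹ • (z q 1 * z q 3)

/-- The elements `a_n = z₁ z₄^* − qⁿ z₂ z₃^*` of `A(S⁷_q)`. -/
def aN [StarRing (PA q)] (n : ℤ) : PA q :=
  z q 0 * star (z q 3) - ((q : ℂ) ^ n) • (z q 1 * star (z q 2))

/-- The elements `b_n = z₁ z₃ + q^{n−1} z₂ z₄` of `A(S⁷_q)`. -/
def bN (n : ℤ) : PA q := z q 0 * z q 2 + ((q : ℂ) ^ (n - 1)) • (z q 1 * z q 3)

/-! ### The coaction, the coinvariants and the canonical map -/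

variable (δ : PA q →ₐ[ℂ] PA q ⊗[ℂ] AU q)

/-- `Δ_r := (id ⊗ r) ∘ Δ : A(S⁷_q) → A(S⁷_q) ⊗ C`, built from the
`A(U_q(4))`-coaction `δ`. -/
def Dr : PA q →ₗ[ℂ] PA q ⊗[ℂ] Cq q :=
  (LinearMap.lTensor (PA q) (rr q)) ∘ₗ δ.toLinearMap

/-- The set of coinvariants `B = A(Σ⁴_q) = {a | Δ_r(a) = a ⊗ r(1)}`. -/
def Bset : Set (PA q) := {a : PA q | Dr q δ a = a ⊗ₜ[ℂ] rr q 1}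

/-- The subspace of `P ⊗ P` spanned by the elements `(u b) ⊗ v − u ⊗ (b v)` with `b`
a coinvariant; quotienting by it produces the balanced tensor product `P ⊗_B P`. -/
def relT : Submodule ℂ (PA q ⊗[ℂ] PA q) :=
  Submodule.span ℂ
    {x : PA q ⊗[ℂ] PA q | ∃ u v b : PA q, b ∈ Bset q δ ∧
      x = (u * b) ⊗ₜ[ℂ] v - u ⊗ₜ[ℂ] (b * v)}

instance : AddCommGroup (PA q ⊗[ℂ] PA q) := TensorProduct.addCommGroup

/-- The balanced tensor product `P ⊗_B P` over the coinvariant subalgebra `B = A(Σ⁴_q)`. -/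
abbrev PBP : Type := (PA q ⊗[ℂ] PA q) ⧸ relT q δ

/-- The canonical projection `P ⊗ P → P ⊗_B P`. -/
def mkT : PA q ⊗[ℂ] PA q →ₗ[ℂ] PBP q δ := (relT q δ).mkQ

lemma relT_map_lmul (p : PA q) {x : PA q ⊗[ℂ] PA q} (hx : x ∈ relT q δ) :
    TensorProduct.map (LinearMap.mulLeft ℂ p) LinearMap.id x ∈ relT q δ := by
  induction hx using Submodule.span_induction with
  | mem y hy =>
      obtain ⟨u, v, b, hb, rfl⟩ := hy
      refine Submodule.subset_span ⟨p * u, v, b, hb, ?_⟩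
      simp [TensorProduct.map_tmul, mul_assoc]
  | zero => simp
  | add u v _ _ hu hv => simpa [map_add] using Submodule.add_mem _ hu hv
  | smul a u _ hu => simpa [map_smul] using Submodule.smul_mem _ a hu

lemma relT_map_rmul (p : PA q) {x : PA q ⊗[ℂ] PA q} (hx : x ∈ relT q δ) :
    TensorProduct.map LinearMap.id (LinearMap.mulRight ℂ p) x ∈ relT q δ := by
  induction hx using Submodule.span_induction with
  | mem y hy =>
      obtain ⟨u, v, b, hb, rfl⟩ := hy
      refine Submodule.subset_span ⟨u, v * p, b, hb, ?_⟩
      simp [TensorProduct.map_tmul, mul_assoc]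
  | zero => simp
  | add u v _ _ hu hv => simpa [map_add] using Submodule.add_mem _ hu hv
  | smul a u _ hu => simpa [map_smul] using Submodule.smul_mem _ a hu

/-- Left multiplication by `p ∈ P` on the bimodule `P ⊗_B P`. -/
def lact (p : PA q) : PBP q δ →ₗ[ℂ] PBP q δ :=
  Submodule.liftQ (relT q δ)
    ((relT q δ).mkQ ∘ₗ TensorProduct.map (LinearMap.mulLeft ℂ p) LinearMap.id)
    (by
      intro x hx
      simp only [LinearMap.mem_ker, LinearMap.comp_apply, Submodule.mkQ_apply,
        Submodule.Quotient.mk_eq_zero]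
      exact relT_map_lmul q δ p hx)

/-- Right multiplication by `p ∈ P` on the bimodule `P ⊗_B P`. -/
def ract (p : PA q) : PBP q δ →ₗ[ℂ] PBP q δ :=
  Submodule.liftQ (relT q δ)
    ((relT q δ).mkQ ∘ₗ TensorProduct.map LinearMap.id (LinearMap.mulRight ℂ p))
    (by
      intro x hx
      simp only [LinearMap.mem_ker, LinearMap.comp_apply, Submodule.mkQ_apply,
        Submodule.Quotient.mk_eq_zero]
      exact relT_map_rmul q δ p hx)

/-- The structure map of the right action `◁` of `A(S⁷_q)` on `A(S⁷_q) ⊗ C`: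
on simple tensors, `(u ⊗ x) ⊗ (w ⊗ y) ↦ (u w) ⊗ (x · y)`.  The action is
`(u ⊗ x) ◁ v = triMap ((u ⊗ x) ⊗ δ v) = Σ u v₍₀₎ ⊗ x · v₍₁₎`. -/
def triMap : (PA q ⊗[ℂ] Cq q) ⊗[ℂ] (PA q ⊗[ℂ] AU q) →ₗ[ℂ] PA q ⊗[ℂ] Cq q :=
  (TensorProduct.map (LinearMap.mul' ℂ (PA q)) (TensorProduct.lift (LinearMap.flip (cact q)))) ∘ₗ
    (TensorProduct.tensorTensorTensorComm ℂ (PA q) (Cq q) (PA q) (AU q)).toLinearMap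

lemma aux_ract_mk (p : PA q) (x : PA q ⊗[ℂ] PA q) :
    ract q δ p (Submodule.Quotient.mk x) =
      Submodule.Quotient.mk (TensorProduct.map LinearMap.id (LinearMap.mulRight ℂ p) x) := rfl

lemma aux_lact_mk (p : PA q) (x : PA q ⊗[ℂ] PA q) :
    lact q δ p (Submodule.Quotient.mk x) =
      Submodule.Quotient.mk (TensorProduct.map (LinearMap.mulLeft ℂ p) LinearMap.id x) := rfl

lemma aux_ract_ract (p p' : PA q) (x : PBP q δ) :
    ract q δ p (ract q δ p' x) = ract q δ (p' * p) x := by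
  obtain ⟨a, rfl⟩ := Submodule.Quotient.mk_surjective _ x
  rw [aux_ract_mk, aux_ract_mk, aux_ract_mk]
  congr 1
  induction a using TensorProduct.induction_on with
  | zero => simp only [map_zero]
  | tmul u v => simp [mul_assoc]
  | add u v hu hv => simp only [map_add, hu, hv]

lemma aux_ract_lact (p p' : PA q) (x : PBP q δ) :
    ract q δ p (lact q δ p' x) = lact q δ p' (ract q δ p x) := by
  obtain ⟨a, rfl⟩ := Submodule.Quotient.mk_surjective _ x
  rw [aux_ract_mk, aux_lact_mk, aux_lact_mk, aux_ract_mk]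
  congr 1
  induction a using TensorProduct.induction_on with
  | zero => simp only [map_zero]
  | tmul u v => simp
  | add u v hu hv => simp only [map_add, hu, hv]

lemma aux_ract_add (p p' : PA q) (x : PBP q δ) :
    ract q δ (p + p') x = ract q δ p x + ract q δ p' x := by
  obtain ⟨a, rfl⟩ := Submodule.Quotient.mk_surjective _ x
  rw [aux_ract_mk, aux_ract_mk, aux_ract_mk, ← Submodule.Quotient.mk_add]
  congr 1
  induction a using TensorProduct.induction_on with
  | zero => simp only [map_zero, add_zero]
  | tmul u v => simp [mul_add, TensorProduct.tmul_add]
  | add u v hu hv => simp only [map_add, hu, hv]; abel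

lemma aux_ract_smul (c : ℂ) (p : PA q) (x : PBP q δ) :
    ract q δ (c • p) x = c • ract q δ p x := by
  obtain ⟨a, rfl⟩ := Submodule.Quotient.mk_surjective _ x
  rw [aux_ract_mk, aux_ract_mk, ← Submodule.Quotient.mk_smul]
  congr 1
  induction a using TensorProduct.induction_on with
  | zero => simp only [map_zero, smul_zero]
  | tmul u v => simp
  | add u v hu hv => simp only [map_add, hu, hv, smul_add]

lemma aux_ract_sub (p p' : PA q) (x : PBP q δ) :
    ract q δ (p - p') x = ract q δ p x - ract q δ p' x := by
  have h := aux_ract_add q δ (p - p') p' x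
  rw [sub_add_cancel] at h
  rw [h, add_sub_cancel_right]

lemma aux_zz {i j : Fin 4} (h : i < j) : z q i * z q j = (q : ℂ) • (z q j * z q i) := by
  simpa only [z, zs, map_mul, map_smul] using RingQuot.mkAlgHom_rel ℂ (relS.zz (q := q) h)

lemma aux_ss {i j : Fin 4} (h : i < j) : zs q j * zs q i = (q : ℂ) • (zs q i * zs q j) := by
  simpa only [z, zs, map_mul, map_smul] using RingQuot.mkAlgHom_rel ℂ (relS.ss (q := q) h)

lemma aux_sz {i j : Fin 4} (h : i ≠ j) : zs q j * z q i = (q : ℂ) • (z q i * zs q j) := by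
  simpa only [z, zs, map_mul, map_smul] using RingQuot.mkAlgHom_rel ℂ (relS.sz (q := q) h)

lemma aux_s0 : zs q 0 * z q 0 = z q 0 * zs q 0 := by
  have h := RingQuot.mkAlgHom_rel ℂ (relS.szz (q := q) (k := 0))
  have e : (Finset.univ.filter (· < (0 : Fin 4))) = ∅ := by decide
  rw [e] at h
  simpa only [z, zs, map_mul, map_add, map_smul, Finset.sum_empty, smul_zero, add_zero] using h

lemma aux_s3 : zs q 3 * z q 3 = z q 3 * zs q 3 + (1 - (q : ℂ) ^ 2) •
    (z q 0 * zs q 0 + z q 1 * zs q 1 + z q 2 * zs q 2) := by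
  have h := RingQuot.mkAlgHom_rel ℂ (relS.szz (q := q) (k := 3))
  have e : (Finset.univ.filter (· < (3 : Fin 4))) = {0, 1, 2} := by decide
  rw [e, Finset.sum_insert (by decide), Finset.sum_insert (by decide), Finset.sum_singleton] at h
  simpa only [z, zs, map_mul, map_add, map_smul, ← add_assoc] using h

lemma aux_sum : z q 0 * zs q 0 + z q 1 * zs q 1 + z q 2 * zs q 2 + z q 3 * zs q 3 = 1 := by
  have h := RingQuot.mkAlgHom_rel ℂ (relS.sum1 (q := q))
  rw [Fin.sum_univ_four] at h
  simpa only [z, zs, map_mul, map_add, map_one] using h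

theorem difficili_tris (q : ℝ) (hq0 : 0 < q) (hq1 : q < 1)
    [StarRing (AU q)] [StarModule ℂ (AU q)]
    (S : AU q →ₗ[ℂ] AU q)
    (hSanti : ∀ x y : AU q, S (x * y) = S y * S x) (hS1 : S 1 = 1)
    (hSleft : ∀ i j : Fin 4, ∑ k : Fin 4, S (tt q i k) * tt q k j = if i = j then 1 else 0)
    (hSright : ∀ i j : Fin 4, ∑ k : Fin 4, tt q i k * S (tt q k j) = if i = j then 1 else 0)
    (hSD : S (Dq q) = dI q) (hSDi : S (dI q) = Dq q)
    (hstarT : ∀ i j : Fin 4, star (tt q i j) = S (tt q j i))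
    (hstarD : star (Dq q) = dI q)
    [StarRing (PA q)] [StarModule ℂ (PA q)]
    (hstarz : ∀ i : Fin 4, star (z q i) = zs q i)
    (δ : PA q →ₐ[ℂ] PA q ⊗[ℂ] AU q)
    (hδz : ∀ i : Fin 4, δ (z q i) = ∑ j : Fin 4, z q j ⊗ₜ[ℂ] tt q j i)
    (hδzs : ∀ i : Fin 4, δ (zs q i) = ∑ j : Fin 4, zs q j ⊗ₜ[ℂ] star (tt q j i))
    (k : ℤ) (hk : 1 ≤ k) (m n : ℕ) (y τ w : PBP q δ)
    (h1 : ((q : ℂ) ^ (m + n)) • lact q δ (z q 1) y + ((q : ℂ) ^ (m + n + 1)) • ract q δ (z q 0) w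
        = ract q δ (z q 1) τ)
    (h2 : lact q δ (z q 2) y - ((q : ℂ) ^ (-k)) • ract q δ (z q 3) w = ract q δ (z q 2) τ)
    (h3 : ((q : ℂ) ^ (m + n)) • lact q δ (star (z q 0)) y
        - ((q : ℂ) ^ (m + n)) • ract q δ (star (z q 1)) w = ract q δ (star (z q 0)) τ)
    (h4 : lact q δ (star (z q 3)) y + ((q : ℂ) ^ (1 - k)) • ract q δ (star (z q 2)) w
        = ract q δ (star (z q 3)) τ)
        : ract q δ (1 - ((q : ℂ) ^ 2) • RRe q) τ
      = lact q δ (star (z q 3)) (ract q δ (z q 3) y)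
        + ((q : ℂ) ^ 2) • lact q δ (z q 2) (ract q δ (star (z q 2)) y) ∧
    ract q δ (RRe q) τ
      = ((q : ℂ) ^ (m + n)) •
          (lact q δ (z q 1) (ract q δ (star (z q 1)) y)
            + lact q δ (star (z q 0)) (ract q δ (z q 0) y)) ∧
    ract q δ (aN q (-(k + (m : ℤ) + n))) τ
      = (q : ℂ)⁻¹ • lact q δ (star (z q 3)) (ract q δ (z q 0) y)
        - ((q : ℂ) ^ (-k)) • lact q δ (z q 1) (ract q δ (star (z q 2)) y) ∧
    ract q δ (bN q (-(k + (m : ℤ) + n))) τ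
      = (q : ℂ) • lact q δ (z q 2) (ract q δ (z q 0) y)
        + ((q : ℂ) ^ (-k - 1)) • lact q δ (z q 1) (ract q δ (z q 3) y) ∧
    ract q δ (star (aN q (k + (m : ℤ) + n))) τ
      = ((q : ℂ) ^ ((m : ℤ) + (n : ℤ) - 1)) • lact q δ (star (z q 0)) (ract q δ (z q 3) y)
        - ((q : ℂ) ^ (k + (m : ℤ) + n)) • lact q δ (z q 2) (ract q δ (star (z q 1)) y) ∧
    ract q δ (star (bN q (k + (m : ℤ) + n))) τ
      = ((q : ℂ) ^ ((m : ℤ) + (n : ℤ) + 1)) • lact q δ (star (z q 0)) (ract q δ (star (z q 2)) y)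
        + ((q : ℂ) ^ (k + (m : ℤ) + n - 1)) • lact q δ (star (z q 3)) (ract q δ (star (z q 1)) y) := by
  have hq : (q : ℂ) ≠ 0 := by exact_mod_cast hq0.ne'
  have sm : ∀ (c : ℂ) (x : PA q), star (c • x) = star c • star x := fun c x => star_smul c x
  have sq : ∀ j : ℤ, star ((q : ℂ) ^ j) = (q : ℂ) ^ j := by
    intro j
    rw [star_zpow₀]
    congr 1
    exact Complex.conj_ofReal q
  have z1 : (q : ℂ) ^ (m + n + 1) = q * (q : ℂ) ^ (m + n) := by ring
  have z2 : (q : ℂ) ^ (1 - k) = q * ((q : ℂ) ^ k)⁻¹ := by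
    rw [zpow_sub₀ hq, zpow_one, div_eq_mul_inv]
  have z3 : (q : ℂ) ^ (-k) = ((q : ℂ) ^ k)⁻¹ := zpow_neg _ _
  have z4 : (q : ℂ) ^ (k + (m : ℤ) + n) = (q : ℂ) ^ k * (q : ℂ) ^ (m + n) := by
    rw [add_assoc, zpow_add₀ hq, ← Nat.cast_add, zpow_natCast]
  have z5 : (q : ℂ) ^ (k + (m : ℤ) + n - 1) = (q : ℂ) ^ k * (q : ℂ) ^ (m + n) * (q : ℂ)⁻¹ := by
    rw [zpow_sub₀ hq, z4, zpow_one, div_eq_mul_inv]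
  have z6 : (q : ℂ) ^ (-(k + (m : ℤ) + n)) = ((q : ℂ) ^ k * (q : ℂ) ^ (m + n))⁻¹ := by
    rw [zpow_neg, z4]
  have z7 : (q : ℂ) ^ (-(k + (m : ℤ) + n) - 1)
      = ((q : ℂ) ^ k * (q : ℂ) ^ (m + n))⁻¹ * (q : ℂ)⁻¹ := by
    rw [zpow_sub₀ hq, z6, zpow_one, div_eq_mul_inv]
  have z8 : (q : ℂ) ^ (-k - 1) = ((q : ℂ) ^ k)⁻¹ * (q : ℂ)⁻¹ := by
    rw [zpow_sub₀ hq, z3, zpow_one, div_eq_mul_inv]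
  have z9 : (q : ℂ) ^ ((m : ℤ) + (n : ℤ) - 1) = (q : ℂ) ^ (m + n) * (q : ℂ)⁻¹ := by
    rw [zpow_sub₀ hq, ← Nat.cast_add, zpow_natCast, zpow_one, div_eq_mul_inv]
  have z10 : (q : ℂ) ^ ((m : ℤ) + (n : ℤ) + 1) = (q : ℂ) ^ (m + n) * (q : ℂ) := by
    rw [zpow_add₀ hq, ← Nat.cast_add, zpow_natCast, zpow_one]
  have ss : ∀ i, star (zs q i) = z q i := fun i => by rw [← hstarz, star_star]
  simp only [aN, bN, RRe, star_sub, star_add, sm, sq, star_mul, hstarz, ss] at h1 h2 h3 h4 ⊢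
  simp only [z1, z2, z3, z4, z5, z6, z7, z8, z9, z10] at h1 h2 h3 h4 ⊢
  have hc : (q : ℂ) ^ k ≠ 0 := zpow_ne_zero _ hq
  have hp : (q : ℂ) ^ (m + n) ≠ 0 := pow_ne_zero _ hq
  clear z1 z2 z3 z4 z5 z6 z7 z8 z9 z10
  generalize (q : ℂ) ^ k = c at *
  generalize (q : ℂ) ^ (m + n) = p at *
  have g1 := fun x => congrArg (ract q δ x) h1
  have g2 := fun x => congrArg (ract q δ x) h2
  have g3 := fun x => congrArg (ract q δ x) h3
  have g4 := fun x => congrArg (ract q δ x) h4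
  simp only [map_add, map_sub, map_smul, aux_ract_lact, aux_ract_ract] at g1 g2 g3 g4
  refine ⟨?_, ?_, ?_, ?_, ?_, ?_⟩
  · have a4 := g4 (z q 3)
    have a2 := g2 (zs q 2)
    have e : (1 : PA q) - (q : ℂ) ^ 2 • (z q 0 * zs q 0 + z q 1 * zs q 1)
        = zs q 3 * z q 3 + (q : ℂ) ^ 2 • (z q 2 * zs q 2) := by
      rw [aux_s3, ← aux_sum q]; module
    rw [aux_sz q (i := 3) (j := 2) (by decide), aux_ract_smul] at a4
    rw [e, aux_ract_add, aux_ract_smul, ← a4, ← a2]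
    module
  · have a1 := g1 (zs q 1)
    have a3 := g3 (z q 0)
    rw [aux_sz q (i := 0) (j := 1) (by decide), aux_ract_smul, aux_s0] at a3
    rw [aux_ract_add, ← a1, ← a3]
    module
  · have a4 := g4 (z q 0)
    have a1 := g1 (zs q 2)
    rw [aux_sz q (i := 0) (j := 2) (by decide), aux_sz q (i := 0) (j := 3) (by decide),
      aux_ract_smul, aux_ract_smul] at a4
    rw [aux_ract_sub, aux_ract_smul, ← a1, ← (inv_smul_eq_iff₀ hq).2 a4]
    match_scalars <;> field_simp <;> ring
  · have a2 := g2 (z q 0)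
    have a1 := g1 (z q 3)
    rw [aux_zz q (i := 0) (j := 3) (by decide), aux_ract_smul] at a1
    rw [aux_ract_add, aux_ract_smul, aux_zz q (i := 0) (j := 2) (by decide), aux_ract_smul,
      ← a1, ← a2]
    match_scalars <;> field_simp <;> ring
  · have a3 := g3 (z q 3)
    have a2 := g2 (zs q 1)
    rw [aux_sz q (i := 3) (j := 0) (by decide), aux_sz q (i := 3) (j := 1) (by decide),
      aux_ract_smul, aux_ract_smul] at a3
    rw [aux_ract_sub, aux_ract_smul, ← a2, ← (inv_smul_eq_iff₀ hq).2 a3]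
    match_scalars <;> field_simp <;> ring
  · have a3 := g3 (zs q 2)
    have a4 := g4 (zs q 1)
    rw [aux_ss q (i := 1) (j := 2) (by decide), aux_ract_smul] at a4
    rw [aux_ract_add, aux_ract_smul, aux_ss q (i := 0) (j := 2) (by decide), aux_ract_smul,
      ← a3, ← a4]
    match_scalars <;> field_simp <;> ring

end QIB
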